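/- Let the stationary setup hold with additionally E[X₀⁴] < ∞. Define G_n = σ(X_k : k ≥ n) for n ≥ 1 and the strong mixing coefficients α_n = sup{ |P(A ∩ B) − P(A)P(B)| : A ∈ F₀, B ∈ G_n }. Then ∑_{n=1}^∞ n^{−3/2} ‖E(S_n | F₀)‖ ≤ 24 ‖X₀‖₄ ∑_{k=1}^∞ k^{−1/2} α_k^{1/4} (both sides possibly infinite), where ‖X₀‖₄ = (E[X₀⁴])^{1/4}. -/

import Mathlib

open MeasureTheory

/-- The `L¹` distance of a conditional expectation to the mean is attained on one event. -/
lemma exists_integral_abs_condExp_sub {Ω : Type*} {m m0 : MeasurableSpace Ω} {P : Measure Ω}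
    [IsProbabilityMeasure P] (hm : m ≤ m0) {Z : Ω → ℝ} (hZ : Integrable Z P) :
    ∃ A, MeasurableSet[m] A ∧ ∫ ω, |(P[Z|m]) ω - ∫ x, Z x ∂P| ∂P =
      2 * (∫ ω in A, Z ω ∂P - P.real A * ∫ x, Z x ∂P) := by
  set c := ∫ x, Z x ∂P
  have hA : MeasurableSet[m] {ω | c ≤ (P[Z|m]) ω} :=
    measurableSet_le measurable_const stronglyMeasurable_condExp.measurable
  refine ⟨_, hA, ?_⟩
  set A := {ω | c ≤ (P[Z|m]) ω}
  have hD : Integrable (fun ω => (P[Z|m]) ω - c) P := integrable_condExp.sub (integrable_const c)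
  have habs : ∀ ω, |(P[Z|m]) ω - c| =
      2 * A.indicator (fun ω => (P[Z|m]) ω - c) ω - ((P[Z|m]) ω - c) := by
    intro ω
    by_cases h : ω ∈ A
    · rw [Set.indicator_of_mem h, abs_of_nonneg (sub_nonneg.2 h)]; ring
    · rw [Set.indicator_of_notMem h, abs_of_neg (sub_neg.2 (not_le.1 h))]; ring
  simp_rw [habs]
  rw [integral_sub ((hD.indicator (hm _ hA)).const_mul 2) hD, integral_const_mul,
    integral_indicator (hm _ hA), integral_sub integrable_condExp.integrableOn
      (integrable_const c).integrableOn, setIntegral_condExp hm hZ hA,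
    integral_sub integrable_condExp (integrable_const c), integral_condExp hm]
  simp [c]

/-- Conditional expectations of bounded functions under strong mixing with coefficient `a`. -/
lemma integral_abs_condExp_sub_le_of_mixing {Ω : Type*} {F G m0 : MeasurableSpace Ω}
    {P : Measure Ω} [IsProbabilityMeasure P] (hF : F ≤ m0) (hG : G ≤ m0) {a : ℝ}
    (ha : ∀ A B, MeasurableSet[F] A → MeasurableSet[G] B →
      |P.real (A ∩ B) - P.real A * P.real B| ≤ a)
    {Z : Ω → ℝ} (hZ : Measurable[G] Z) {M : ℝ} (hM : ∀ ω, |Z ω| ≤ M) :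
    ∫ ω, |(P[Z|F]) ω - ∫ x, Z x ∂P| ∂P ≤ 4 * a * M := by
  obtain ⟨ω₀⟩ : Nonempty Ω := nonempty_of_isProbabilityMeasure P
  have hM0 : 0 ≤ M := (abs_nonneg _).trans (hM ω₀)
  have hZi : Integrable Z P :=
    Integrable.of_bound (hZ.mono hG le_rfl).aestronglyMeasurable M (ae_of_all _ hM)
  obtain ⟨A, hA, hAeq⟩ := exists_integral_abs_condExp_sub hF hZi
  have hAi : Integrable (A.indicator fun _ => (1 : ℝ)) P :=
    (integrable_const 1).indicator (hF _ hA)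
  obtain ⟨B, hB, hBeq⟩ := exists_integral_abs_condExp_sub hG hAi
  have hEA : ∫ x, A.indicator (fun _ => (1 : ℝ)) x ∂P = P.real A := by
    simp [integral_indicator (hF _ hA)]
  rw [hEA] at hBeq
  have hBint : ∫ ω in B, A.indicator (fun _ => (1 : ℝ)) ω ∂P = P.real (A ∩ B) := by
    rw [setIntegral_indicator (hF _ hA), Set.inter_comm]; simp
  have hZA : Integrable (Z * A.indicator fun _ => (1 : ℝ)) P :=
    hAi.bdd_mul hZi.aestronglyMeasurable (ae_of_all _ hM)
  have hpull := condExp_mul_of_stronglyMeasurable_left (m := G) hZ.stronglyMeasurable hZA hAi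
  have hcov : ∫ ω in A, Z ω ∂P - P.real A * ∫ x, Z x ∂P =
      ∫ ω, Z ω * ((P[A.indicator fun _ => (1 : ℝ)|G]) ω - P.real A) ∂P := by
    have h1 : Integrable (fun ω => Z ω * (P[A.indicator fun _ => (1 : ℝ)|G]) ω) P :=
      integrable_condExp.bdd_mul hZi.aestronglyMeasurable (ae_of_all _ hM)
    simp_rw [mul_sub]
    rw [integral_sub h1 (hZi.mul_const _), integral_mul_const, mul_comm (P.real A)]
    congr 1
    have h2 := integral_congr_ae hpull
    rw [integral_condExp hG] at h2
    refine Eq.trans ?_ h2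
    rw [← integral_indicator (hF _ hA)]
    congr 1 with ω
    by_cases h : ω ∈ A <;> simp [h]
  have hle : ∫ ω, Z ω * ((P[A.indicator fun _ => (1 : ℝ)|G]) ω - P.real A) ∂P ≤
      ∫ ω, M * |(P[A.indicator fun _ => (1 : ℝ)|G]) ω - P.real A| ∂P := by
    have hi : Integrable (fun ω => (P[A.indicator fun _ => (1 : ℝ)|G]) ω - P.real A) P :=
      integrable_condExp.sub (integrable_const _)
    refine integral_mono (hi.bdd_mul hZi.aestronglyMeasurable (ae_of_all _ hM))
      (hi.abs.const_mul M) fun ω => ?_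
    refine (le_abs_self _).trans ?_
    rw [abs_mul]
    exact mul_le_mul_of_nonneg_right (hM ω) (abs_nonneg _)
  rw [integral_const_mul, hBeq, hBint] at hle
  have hmix := (le_abs_self _).trans (ha A B hA hB)
  rw [hAeq, hcov]
  nlinarith [mul_le_mul_of_nonneg_left hmix hM0, mul_comm (P.real A) (P.real B)]

/-- Truncation bound for the second moment of a conditional expectation under mixing. -/
lemma integral_condExp_sq_le_of_mixing {Ω : Type*} {F G m0 : MeasurableSpace Ω}
    {P : Measure Ω} [IsProbabilityMeasure P] (hF : F ≤ m0) (hG : G ≤ m0) {a : ℝ}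
    (ha : ∀ A B, MeasurableSet[F] A → MeasurableSet[G] B →
      |P.real (A ∩ B) - P.real A * P.real B| ≤ a)
    {X : Ω → ℝ} (hX : Measurable[G] X) (hX2 : MemLp X 2 P)
    (hX4 : Integrable (fun ω => X ω ^ 4) P) (hmean : ∫ ω, X ω ∂P = 0) {M : ℝ} (hM : 0 < M) :
    ∫ ω, (P[X|F]) ω ^ 2 ∂P ≤ 16 * a * M ^ 2 + 2 * (∫ ω, X ω ^ 4 ∂P) / M ^ 2 := by
  have hK : MeasurableSet[G] {ω | |X ω| ≤ M} := (measurable_id.abs.comp hX) measurableSet_Iic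
  set K := {ω | |X ω| ≤ M}
  set U := K.indicator X
  set V := Kᶜ.indicator X
  have hU : Measurable[G] U := hX.indicator hK
  have hUM : ∀ ω, |U ω| ≤ M := fun ω => by
    by_cases h : ω ∈ K
    · rw [show U ω = X ω from Set.indicator_of_mem h X]; exact h
    · simpa [U, h] using hM.le
  have hU2 : MemLp U 2 P := hX2.indicator (hG _ hK)
  have hV2 : MemLp V 2 P := hX2.indicator (hG _ hK).compl
  set u := ∫ x, U x ∂P
  set v := ∫ x, V x ∂P
  have hUi := hU2.integrable one_le_two
  have hVi := hV2.integrable one_le_two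
  have hUV : U + V = X := Set.indicator_self_add_compl K X
  have huv : u + v = 0 := by
    rw [← hmean, ← hUV]; exact (integral_add hUi hVi).symm
  set W : Ω → ℝ := fun ω => V ω - v
  have hW2 : MemLp W 2 P := hV2.sub (memLp_const v)
  have hcW : MemLp (P[W|F]) 2 P := hW2.condExp one_le_two
  have hcU : MemLp (P[U|F]) 2 P := hU2.condExp one_le_two
  have hD2 : Integrable (fun ω => ((P[U|F]) ω - u) ^ 2) P := (hcU.sub (memLp_const u)).integrable_sq
  have hD : Integrable (fun ω => |(P[U|F]) ω - u|) P :=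
    (integrable_condExp.sub (integrable_const u)).abs
  have hsplit : P[X|F] =ᵐ[P] fun ω => ((P[U|F]) ω - u) + (P[W|F]) ω := by
    have hXW : X = (U - fun _ => u) + W := by
      rw [← hUV]; ext ω; simp only [W, Pi.add_apply, Pi.sub_apply]; linarith
    have h1 := condExp_add (hUi.sub (integrable_const u)) (hW2.integrable one_le_two) F
    have h2 := condExp_sub hUi (integrable_const u) F
    rw [← hXW] at h1
    filter_upwards [h1, h2] with ω e1 e2
    rw [e1, Pi.add_apply, e2, Pi.sub_apply, condExp_const hF]
  have hW : ∫ ω, (P[W|F]) ω ^ 2 ∂P ≤ (∫ ω, X ω ^ 4 ∂P) / M ^ 2 := by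
    have h1 := integral_norm_condExp_rpow_le (m := F) (μ := P) (f := W) one_le_two
      (by simpa using hW2.integrable_sq)
    simp only [Real.norm_eq_abs, Real.rpow_two, sq_abs] at h1
    have h2 : ∫ ω, W ω ^ 2 ∂P ≤ ∫ ω, V ω ^ 2 ∂P := by
      have := ProbabilityTheory.variance_le_expectation_sq (μ := P) hV2.aestronglyMeasurable
      rwa [ProbabilityTheory.variance_eq_integral hV2.aestronglyMeasurable.aemeasurable] at this
    have h3 : ∫ ω, V ω ^ 2 ∂P ≤ ∫ ω, X ω ^ 4 / M ^ 2 ∂P := by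
      refine integral_mono hV2.integrable_sq (hX4.div_const _) fun ω => ?_
      by_cases h : ω ∈ K
      · have : V ω = 0 := by simp [V, h]
        simp only [this, zero_pow two_ne_zero]; positivity
      · have hV : V ω = X ω := by simp [V, h]
        have hlt : M ^ 2 ≤ X ω ^ 2 := by
          rw [← sq_abs (X ω)]
          exact pow_le_pow_left₀ hM.le (not_le.1 h).le 2
        simp only [hV]
        rw [le_div_iff₀ (by positivity)]
        nlinarith [sq_nonneg (X ω)]
    rw [integral_div] at h3
    exact h1.trans (h2.trans h3)
  have hUb : ∫ ω, ((P[U|F]) ω - u) ^ 2 ∂P ≤ 2 * M * (4 * a * M) := by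
    have hu : |u| ≤ M := by
      refine (abs_integral_le_integral_abs).trans ?_
      simpa using integral_mono hUi.abs (integrable_const M) hUM
    refine le_trans ?_ (mul_le_mul_of_nonneg_left
      (integral_abs_condExp_sub_le_of_mixing hF hG ha hU hUM) (by positivity))
    rw [← integral_const_mul]
    refine integral_mono_ae hD2 (hD.const_mul _) ?_
    filter_upwards [ae_bdd_abs_condExp_of_ae_bdd_abs (m := F) (ae_of_all P hUM)] with ω hω
    have : |(P[U|F]) ω - u| ≤ 2 * M := (abs_sub _ _).trans (by linarith)
    rw [← sq_abs, sq]
    exact mul_le_mul_of_nonneg_right this (abs_nonneg _)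
  have hbound : ∫ ω, (P[X|F]) ω ^ 2 ∂P ≤
      ∫ ω, (2 * ((P[U|F]) ω - u) ^ 2 + 2 * (P[W|F]) ω ^ 2) ∂P := by
    refine integral_mono_ae (hX2.condExp one_le_two).integrable_sq
      ((hD2.const_mul 2).add (hcW.integrable_sq.const_mul 2)) ?_
    filter_upwards [hsplit] with ω hω
    rw [hω]
    nlinarith [sq_nonneg ((P[U|F]) ω - u - (P[W|F]) ω)]
  rw [integral_add (hD2.const_mul 2) (hcW.integrable_sq.const_mul 2), integral_const_mul,
    integral_const_mul] at hbound
  rw [mul_div_assoc]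
  nlinarith

/-- Fourth-moment bound for the `L²` norm of a conditional expectation under mixing. -/
lemma sqrt_integral_condExp_sq_le_of_mixing {Ω : Type*} {F G m0 : MeasurableSpace Ω}
    {P : Measure Ω} [IsProbabilityMeasure P] (hF : F ≤ m0) (hG : G ≤ m0) {a : ℝ}
    (ha : ∀ A B, MeasurableSet[F] A → MeasurableSet[G] B →
      |P.real (A ∩ B) - P.real A * P.real B| ≤ a)
    {X : Ω → ℝ} (hX : Measurable[G] X) (hX2 : MemLp X 2 P)
    (hX4 : Integrable (fun ω => X ω ^ 4) P) (hmean : ∫ ω, X ω ∂P = 0) :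
    √(∫ ω, (P[X|F]) ω ^ 2 ∂P) ≤
      8 * (∫ ω, X ω ^ 4 ∂P) ^ ((1 : ℝ) / 4) * a ^ ((1 : ℝ) / 4) := by
  have ha0 : 0 ≤ a := (abs_nonneg _).trans (ha ∅ ∅
    (@MeasurableSet.empty _ F) (@MeasurableSet.empty _ G))
  have hN0 : 0 ≤ ∫ ω, X ω ^ 4 ∂P := integral_nonneg fun ω => by positivity
  have hM := fun M hM => integral_condExp_sq_le_of_mixing hF hG ha hX hX2 hX4 hmean (M := M) hM
  set N := ∫ ω, X ω ^ 4 ∂P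
  set y := ∫ ω, (P[X|F]) ω ^ 2 ∂P
  have hy : ∀ ε > 0, y ≤ 18 * (√(a + ε) * √(N + ε)) := by
    intro ε hε
    have hp : 0 < √(a + ε) := Real.sqrt_pos.2 (by linarith)
    have hq : 0 < √(N + ε) := Real.sqrt_pos.2 (by linarith)
    have h := hM (√(√(N + ε) / √(a + ε))) (Real.sqrt_pos.2 (div_pos hq hp))
    rw [Real.sq_sqrt (div_pos hq hp).le] at h
    have hp2 := Real.sq_sqrt (show 0 ≤ a + ε by linarith)
    have hq2 := Real.sq_sqrt (show 0 ≤ N + ε by linarith)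
    set p := √(a + ε)
    set q := √(N + ε)
    calc y ≤ 16 * a * (q / p) + 2 * N / (q / p) := h
      _ ≤ 16 * p ^ 2 * (q / p) + 2 * q ^ 2 / (q / p) := by
        gcongr <;> linarith
      _ = 18 * (p * q) := by field_simp; norm_num
  have hlim : y ≤ 18 * (√a * √N) := by
    have hc : Filter.Tendsto (fun ε : ℝ => 18 * (√(a + ε) * √(N + ε)))
        (nhdsWithin 0 (Set.Ioi 0)) (nhds (18 * (√(a + 0) * √(N + 0)))) :=
      (Continuous.tendsto (by fun_prop) 0).mono_left nhdsWithin_le_nhds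
    rw [add_zero, add_zero] at hc
    exact ge_of_tendsto hc (eventually_mem_nhdsWithin.mono hy)
  have hquart : ∀ x : ℝ, 0 ≤ x → (x ^ ((1 : ℝ) / 4)) ^ 2 = √x := by
    intro x hx
    rw [← Real.rpow_natCast, ← Real.rpow_mul hx, Real.sqrt_eq_rpow]; norm_num
  apply Real.sqrt_le_iff.2 ⟨by positivity, ?_⟩
  rw [mul_pow, mul_pow, hquart N hN0, hquart a ha0]
  nlinarith [mul_nonneg (Real.sqrt_nonneg a) (Real.sqrt_nonneg N)]

/-- Bound of `∑_{k ≤ n < N} (n + 1)^{-3/2}` by `3 (k + 1)^{-1/2}` minus a telescoping remainder. -/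
lemma sum_Ico_rpow_neg_three_halves_le (k N : ℕ) (hN : k + 1 ≤ N) :
    ∑ n ∈ Finset.Ico k N, ((n : ℝ) + 1) ^ (-(3 : ℝ) / 2) ≤
      3 * ((k : ℝ) + 1) ^ (-(1 : ℝ) / 2) - 2 * (N : ℝ) ^ (-(1 : ℝ) / 2) := by
  have h1 : ∀ x : ℝ, 0 < x → x ^ (-(1 : ℝ) / 2) = (√x)⁻¹ := fun x hx => by
    rw [neg_div, Real.rpow_neg hx.le, Real.sqrt_eq_rpow]
  have h3 : ∀ x : ℝ, 0 < x → x ^ (-(3 : ℝ) / 2) = ((√x) ^ 3)⁻¹ := fun x hx => by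
    rw [neg_div, Real.rpow_neg hx.le, Real.sqrt_eq_rpow, ← Real.rpow_natCast, ← Real.rpow_mul hx.le]
    norm_num
  induction N, hN using Nat.le_induction with
  | base =>
    have hk : (0 : ℝ) < k + 1 := by positivity
    have hs : 1 ≤ √((k : ℝ) + 1) := Real.one_le_sqrt.2 (by simp)
    simp only [Nat.Ico_succ_singleton, Finset.sum_singleton, Nat.cast_add, Nat.cast_one]
    rw [h1 _ hk, h3 _ hk]
    have : (√((k : ℝ) + 1) ^ 3)⁻¹ ≤ (√((k : ℝ) + 1))⁻¹ :=
      inv_anti₀ (by positivity) (le_self_pow₀ hs (by norm_num))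
    linarith
  | succ N hN ih =>
    rw [Finset.sum_Ico_succ_top (by omega)]
    have hN0 : (0 : ℝ) < N := by exact_mod_cast (by omega : 0 < N)
    have hN1 : (0 : ℝ) < N + 1 := by positivity
    push_cast
    rw [h1 _ hN0] at ih
    rw [h1 _ hN1, h3 _ hN1]
    have ha := Real.sq_sqrt hN0.le
    have hb := Real.sq_sqrt hN1.le
    have hab : √(N : ℝ) ≤ √((N : ℝ) + 1) := Real.sqrt_le_sqrt (by linarith)
    have ha0 := Real.sqrt_pos.2 hN0
    have hb0 := Real.sqrt_pos.2 hN1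
    set p := √(N : ℝ)
    set q := √((N : ℝ) + 1)
    have key : (q ^ 3)⁻¹ ≤ 2 * p⁻¹ - 2 * q⁻¹ := by
      have e : 2 * p⁻¹ - 2 * q⁻¹ = 2 * (q - p) / (p * q) := by field_simp
      have e2 : (q - p) * (q + p) = 1 := by nlinarith
      rw [e, inv_eq_one_div, div_le_div_iff₀ (by positivity) (by positivity)]
      have h5 : p * (q + p) ≤ 2 * q ^ 2 := by nlinarith
      have h6 : 0 ≤ q - p := by linarith
      calc 1 * (p * q) = (q - p) * q * (p * (q + p)) := by linear_combination -p * q * e2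
        _ ≤ (q - p) * q * (2 * q ^ 2) := by gcongr
        _ = _ := by ring
    linarith

/-- Interchange of summation against the weights `(n + 1)^{-3/2}`. -/
lemma tsum_rpow_mul_sum_range_le (b : ℕ → ENNReal) :
    ∑' n : ℕ, ENNReal.ofReal (((n : ℝ) + 1) ^ (-(3 : ℝ) / 2)) * ∑ k ∈ Finset.range (n + 1), b k ≤
      ENNReal.ofReal 3 * ∑' k : ℕ, ENNReal.ofReal (((k : ℝ) + 1) ^ (-(1 : ℝ) / 2)) * b k := by
  have hswap : ∀ n : ℕ, ENNReal.ofReal (((n : ℝ) + 1) ^ (-(3 : ℝ) / 2)) *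
      ∑ k ∈ Finset.range (n + 1), b k = ∑' k : ℕ, (if k ≤ n then
        ENNReal.ofReal (((n : ℝ) + 1) ^ (-(3 : ℝ) / 2)) else 0) * b k := by
    intro n
    rw [Finset.mul_sum, tsum_eq_sum (s := Finset.range (n + 1))]
    · exact Finset.sum_congr rfl fun k hk => by
        rw [if_pos (Nat.lt_succ_iff.1 (Finset.mem_range.1 hk))]
    · intro k hk
      rw [if_neg (by simpa using hk), zero_mul]
  simp_rw [hswap]
  rw [ENNReal.tsum_comm, ← ENNReal.tsum_mul_left]
  refine ENNReal.tsum_le_tsum fun k => ?_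
  rw [ENNReal.tsum_mul_right, ← mul_assoc, ← ENNReal.ofReal_mul (by norm_num)]
  gcongr
  refine ENNReal.tsum_le_of_sum_range_le fun N => ?_
  rw [← Finset.sum_filter]
  have hIco : (Finset.range N).filter (k ≤ ·) = Finset.Ico k N := by
    ext n; simp [and_comm]
  rw [hIco, ← ENNReal.ofReal_sum_of_nonneg fun n _ => by positivity]
  apply ENNReal.ofReal_le_ofReal
  rcases Nat.lt_or_ge k N with h | h
  · have := sum_Ico_rpow_neg_three_halves_le k N h
    have : 0 ≤ (N : ℝ) ^ (-(1 : ℝ) / 2) := by positivity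
    linarith
  · rw [Finset.Ico_eq_empty_of_le h, Finset.sum_empty]
    positivity

/-- The `L²` norm as the square root of the second moment. -/
lemma ofReal_sqrt_integral_sq {Ω : Type*} {m0 : MeasurableSpace Ω} {P : Measure Ω} {f : Ω → ℝ}
    (hf : MemLp f 2 P) : ENNReal.ofReal √(∫ ω, f ω ^ 2 ∂P) = eLpNorm f 2 P := by
  rw [hf.eLpNorm_eq_integral_rpow_norm (by norm_num) (by norm_num), Real.sqrt_eq_rpow]
  simp

/-- Every coordinate of a shift-generated sequence is measurable. -/
lemma measurable_of_shift {Ω : Type*} {m0 : MeasurableSpace Ω} (T : Ω ≃ᵐ Ω) {X : ℤ → Ω → ℝ}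
    (hX0meas : Measurable (X 0)) (hshift : ∀ k : ℤ, ∀ ω, X (k + 1) ω = X k (T ω)) (k : ℤ) :
    Measurable (X k) := by
  induction k using Int.induction_on with
  | zero => exact hX0meas
  | succ k ih =>
    rw [show X (k + 1) = X k ∘ T from funext (hshift k)]
    exact ih.comp T.measurable
  | pred k ih =>
    have h : X (-k - 1) = X (-k) ∘ T.symm := by
      ext ω
      have := hshift (-k - 1) (T.symm ω)
      rw [T.apply_symm_apply, sub_add_cancel] at this
      exact this.symm
    rw [h]
    exact ih.comp T.symm.measurable

/-- Functions of one coordinate of a stationary sequence have the same integral at all times. -/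
lemma integral_comp_of_shift {Ω : Type*} {m0 : MeasurableSpace Ω} {P : Measure Ω} (T : Ω ≃ᵐ Ω)
    (hT : MeasurePreserving T P P) {X : ℤ → Ω → ℝ}
    (hshift : ∀ k : ℤ, ∀ ω, X (k + 1) ω = X k (T ω)) (g : ℝ → ℝ) (k : ℕ) :
    (Integrable (fun ω => g (X 0 ω)) P → Integrable (fun ω => g (X k ω)) P) ∧
      ∫ ω, g (X k ω) ∂P = ∫ ω, g (X 0 ω) ∂P := by
  induction k with
  | zero => exact ⟨id, rfl⟩
  | succ k ih =>
    have h : (fun ω => g (X (k + 1 : ℕ) ω)) = (fun ω => g (X k ω)) ∘ T := by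
      ext ω
      simp [← hshift]
    rw [h]
    exact ⟨fun hg => (hT.integrable_comp_emb T.measurableEmbedding).2 (ih.1 hg),
      (hT.integral_comp T.measurableEmbedding _).trans ih.2⟩

/-- Under the stationary setup with `E[X₀⁴] < ∞`,
`∑_{n≥1} n^{-3/2} ‖E(Sₙ | F₀)‖ ≤ 24 ‖X₀‖₄ ∑_{k≥1} k^{-1/2} α_k^{1/4}`,
both sides possibly infinite (stated in `ℝ≥0∞`). -/
theorem MW_series_bound
    {Ω : Type*} [MeasurableSpace Ω] (P : Measure Ω) [IsProbabilityMeasure P]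
    (T : Ω ≃ᵐ Ω) (hT : MeasurePreserving T P P)
    (X : ℤ → Ω → ℝ) (hX0meas : Measurable (X 0))
    (hshift : ∀ k : ℤ, ∀ ω, X (k + 1) ω = X k (T ω))
    (hX2 : Integrable (fun ω => (X 0 ω) ^ 2) P)
    (hX4 : Integrable (fun ω => (X 0 ω) ^ 4) P)
    (hmean : ∫ ω, X 0 ω ∂P = 0)
    (S : ℕ → Ω → ℝ)
    (hS : ∀ n, S n = fun ω => ∑ i ∈ Finset.range n, X (i + 1) ω)
    (F0 : MeasurableSpace Ω)
    (hF0 : F0 = ⨆ k ∈ Set.Iic (0 : ℤ), MeasurableSpace.comap (X k) (borel ℝ))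
    (G : ℕ → MeasurableSpace Ω)
    (hG : ∀ n, G n = ⨆ k ∈ Set.Ici (n : ℤ), MeasurableSpace.comap (X k) (borel ℝ))
    (α : ℕ → ℝ)
    (hα : ∀ n, α n = sSup {x : ℝ | ∃ A B : Set Ω, MeasurableSet[F0] A ∧
        MeasurableSet[G n] B ∧
        x = |(P (A ∩ B)).toReal - (P A).toReal * (P B).toReal|}) :
    ∑' n : ℕ, ENNReal.ofReal (((n : ℝ) + 1) ^ (-(3 : ℝ) / 2) *
        Real.sqrt (∫ ω, ((P[S (n + 1)|F0]) ω) ^ 2 ∂P)) ≤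
      ENNReal.ofReal (24 * (∫ ω, (X 0 ω) ^ 4 ∂P) ^ ((1 : ℝ) / 4)) *
        ∑' k : ℕ, ENNReal.ofReal (((k : ℝ) + 1) ^ (-(1 : ℝ) / 2) *
          (α (k + 1)) ^ ((1 : ℝ) / 4)) := by
  have hmeas := measurable_of_shift T hX0meas hshift
  have hcomp := integral_comp_of_shift T hT hshift
  have hF0le := hF0.trans_le (iSup₂_le fun k _ => (hmeas k).comap_le)
  have hGle := fun n => (hG n).trans_le (iSup₂_le fun k _ => (hmeas k).comap_le)
  have hXG : ∀ n : ℕ, Measurable[G n] (X n) := fun n => by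
    rw [measurable_iff_comap_le, hG n]
    exact le_iSup₂_of_le (n : ℤ) Set.self_mem_Ici le_rfl
  have hmix : ∀ n A B, MeasurableSet[F0] A → MeasurableSet[G n] B →
      |P.real (A ∩ B) - P.real A * P.real B| ≤ α n := by
    intro n A B hA hB
    rw [hα n]
    refine le_csSup ⟨1, ?_⟩ ⟨A, B, hA, hB, rfl⟩
    rintro _ ⟨A, B, -, -, rfl⟩
    change |P.real (A ∩ B) - P.real A * P.real B| ≤ 1
    exact abs_sub_le_of_nonneg_of_le measureReal_nonneg measureReal_le_one (by positivity)
      (mul_le_one₀ measureReal_le_one measureReal_nonneg measureReal_le_one)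
  have hL2 : ∀ n : ℕ, MemLp (X n) 2 P := fun n =>
    (memLp_two_iff_integrable_sq (hmeas n).aestronglyMeasurable).2 ((hcomp (· ^ 2) n).1 hX2)
  set C := (∫ ω, (X 0 ω) ^ 4 ∂P) ^ ((1 : ℝ) / 4)
  have hC : 0 ≤ C := Real.rpow_nonneg (integral_nonneg fun ω => by positivity) _
  have hterm : ∀ k : ℕ, eLpNorm (P[X (k + 1 : ℕ)|F0]) 2 P ≤
      ENNReal.ofReal (8 * C) * ENNReal.ofReal (α (k + 1) ^ ((1 : ℝ) / 4)) := by
    intro k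
    rw [← ofReal_sqrt_integral_sq ((hL2 (k + 1)).condExp one_le_two),
      ← ENNReal.ofReal_mul (by positivity)]
    have hmk : ∫ ω, X (k + 1 : ℕ) ω ∂P = 0 := (hcomp id (k + 1)).2.trans hmean
    have h := sqrt_integral_condExp_sq_le_of_mixing hF0le (hGle (k + 1)) (hmix (k + 1))
      (hXG (k + 1)) (hL2 (k + 1)) ((hcomp (· ^ 4) (k + 1)).1 hX4) hmk
    rw [(hcomp (· ^ 4) (k + 1)).2] at h
    exact ENNReal.ofReal_le_ofReal h
  have hsum : ∀ n : ℕ, ENNReal.ofReal √(∫ ω, ((P[S (n + 1)|F0]) ω) ^ 2 ∂P) ≤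
      ∑ k ∈ Finset.range (n + 1),
        ENNReal.ofReal (8 * C) * ENNReal.ofReal (α (k + 1) ^ ((1 : ℝ) / 4)) := by
    intro n
    have hSn : S (n + 1) = ∑ k ∈ Finset.range (n + 1), X (k + 1 : ℕ) := by
      rw [hS]; ext ω; simp
    have hSL2 : MemLp (S (n + 1)) 2 P := hSn ▸ memLp_finsetSum' _ fun k _ => hL2 (k + 1)
    rw [ofReal_sqrt_integral_sq (hSL2.condExp one_le_two), hSn, eLpNorm_congr_ae
      (condExp_finsetSum (fun k _ => (hL2 (k + 1)).integrable one_le_two) F0)]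
    refine (eLpNorm_sum_le (fun k _ => integrable_condExp.aestronglyMeasurable) one_le_two).trans ?_
    exact Finset.sum_le_sum fun k _ => hterm k
  calc _ = ∑' n : ℕ, ENNReal.ofReal (((n : ℝ) + 1) ^ (-(3 : ℝ) / 2)) *
        ENNReal.ofReal √(∫ ω, ((P[S (n + 1)|F0]) ω) ^ 2 ∂P) :=
        tsum_congr fun n => ENNReal.ofReal_mul (by positivity)
    _ ≤ _ := ENNReal.tsum_le_tsum fun n => mul_le_mul_right (hsum n) _
    _ ≤ _ := tsum_rpow_mul_sum_range_le _
    _ = _ := by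
      simp_rw [mul_left_comm _ (ENNReal.ofReal (8 * C))]
      rw [ENNReal.tsum_mul_left, ← mul_assoc, ← ENNReal.ofReal_mul (by norm_num), ← mul_assoc]
      norm_num1
      congr 1
      exact tsum_congr fun k => (ENNReal.ofReal_mul (by positivity)).symm
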